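/- Fix K ≥ 1 FRBs per FDC and N ≥ 4 FDCs, with nonnegative interference gains g^{(n,m)}_{l,k,i} (n ≠ m), positive direct gains g^{(n,n)}_{l,k,k}, and noise constant c > 0. Suppose g^{(n,m)}_{l,k,i} = 0 for all l, k, i whenever n ≥ 4 or m ≥ 4 (with n ≠ m). Then for every allocation tuple (σ_1, …, σ_N): S_l^{(n)} = g^{(n,n)}_{l,σ_n(l),σ_n(l)} / c for every n ≥ 4, and for n ≤ 3 the value S_l^{(n)} depends only on (σ_1, σ_2, σ_3). Consequently, max over all allocation tuples of min over l, n of S_l^{(n)} = min( max over (σ_1, σ_2, σ_3) of min over l and n ≤ 3 of S_l^{(n)}(σ_1, σ_2, σ_3), min over n ≥ 4 of max over permutations σ of Fin K of min over l of g^{(n,n)}_{l,σ(l),σ(l)} / c ). -/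

import Mathlib

open Finset

/-- The SINR in FRB `l` of FDC `n` under the allocation tuple `σ`. -/
noncomputable def SINR {K N : ℕ} (g : Fin N → Fin N → Fin K → Fin K → Fin K → ℝ) (c : ℝ)
    (σ : Fin N → Equiv.Perm (Fin K)) (l : Fin K) (n : Fin N) : ℝ :=
  g n n l (σ n l) (σ n l) / ((∑ m ∈ Finset.univ.erase n, g n m l (σ n l) (σ m l)) + c)

/-- Extend a triple of permutations (the allocations of the first three FDCs,
indices `0,1,2`) to a full allocation tuple, using the identity elsewhere. -/
def ext3 {K N : ℕ}
    (t : Equiv.Perm (Fin K) × Equiv.Perm (Fin K) × Equiv.Perm (Fin K)) :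
    Fin N → Equiv.Perm (Fin K) := fun m =>
  if m.val = 0 then t.1 else if m.val = 1 then t.2.1 else if m.val = 2 then t.2.2 else 1

/-- An FDC that receives no interference has SINR equal to its signal-to-noise ratio. -/
theorem SINR_eq_div_of_interference_eq_zero {K N : ℕ}
    {g : Fin N → Fin N → Fin K → Fin K → Fin K → ℝ} (c : ℝ)
    (σ : Fin N → Equiv.Perm (Fin K)) (l : Fin K) {n : Fin N}
    (h : ∀ m, n ≠ m → ∀ k i, g n m l k i = 0) :
    SINR g c σ l n = g n n l (σ n l) (σ n l) / c := by
  rw [SINR, Finset.sum_eq_zero fun m hm => h m (Finset.ne_of_mem_erase hm).symm _ _, zero_add]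

/-- The SINR of an FDC depends only on its own allocation and those of its interferers. -/
theorem SINR_congr {K N : ℕ}
    {g : Fin N → Fin N → Fin K → Fin K → Fin K → ℝ} (c : ℝ)
    {σ σ' : Fin N → Equiv.Perm (Fin K)} (l : Fin K) {n : Fin N} (hn : σ n = σ' n)
    (h : ∀ m, n ≠ m → σ m = σ' m ∨ ∀ k i, g n m l k i = 0) :
    SINR g c σ l n = SINR g c σ' l n := by
  have hsum : ∑ m ∈ Finset.univ.erase n, g n m l (σ n l) (σ m l) =
      ∑ m ∈ Finset.univ.erase n, g n m l (σ' n l) (σ' m l) := by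
    refine Finset.sum_congr rfl fun m hm => ?_
    rcases h m (Finset.ne_of_mem_erase hm).symm with h | h
    · rw [hn, h]
    · rw [h, h]
  rw [SINR, SINR, hsum, hn]

/-- On the first three FDCs, `ext3` recovers the allocations it was built from. -/
theorem ext3_apply_of_lt_three {K N : ℕ} (hN : 3 ≤ N) (σ : Fin N → Equiv.Perm (Fin K))
    {m : Fin N} (hm : (m : ℕ) < 3) :
    ext3 (σ ⟨0, by omega⟩, σ ⟨1, by omega⟩, σ ⟨2, by omega⟩) m = σ m := by
  obtain ⟨m, hmN⟩ := m
  dsimp only at hm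
  interval_cases m <;> rfl

/-- reduction from `N = 3` to fixed `N ≥ 4` in the proof of Theorem 1.
If there is no interference to or from the FDCs with index `≥ 4` (0-indexed: `≥ 3`),
then: the SINR in any such FDC is `g^{(n,n)}/c`; the SINR in the first three FDCs
depends only on `(σ₁, σ₂, σ₃)`; and the max-min SINR of the whole system is the
minimum of the three-FDC max-min value and the single-FDC max-min values of the
remaining FDCs. -/
theorem stmt_15 (K N : ℕ) [NeZero K] (hN : 4 ≤ N)
    (g : Fin N → Fin N → Fin K → Fin K → Fin K → ℝ) (c : ℝ) (hc : 0 < c)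
    (hdir : ∀ n l k, 0 < g n n l k k)
    (hint : ∀ n m l k i, n ≠ m → 0 ≤ g n m l k i)
    (hzero : ∀ (n m : Fin N) (l k i : Fin K), n ≠ m →
      (3 ≤ (n : ℕ) ∨ 3 ≤ (m : ℕ)) → g n m l k i = 0) :
    (∀ (σ : Fin N → Equiv.Perm (Fin K)) (l : Fin K) (n : Fin N), 3 ≤ (n : ℕ) →
      SINR g c σ l n = g n n l (σ n l) (σ n l) / c) ∧
    (∀ (σ σ' : Fin N → Equiv.Perm (Fin K)),
      (∀ m : Fin N, (m : ℕ) < 3 → σ m = σ' m) →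
      ∀ (l : Fin K) (n : Fin N), (n : ℕ) < 3 →
        SINR g c σ l n = SINR g c σ' l n) ∧
    (Finset.univ.sup' ⟨fun _ => 1, Finset.mem_univ _⟩
        (fun σ : Fin N → Equiv.Perm (Fin K) =>
          Finset.univ.inf' ⟨((0 : Fin K), (⟨0, by omega⟩ : Fin N)), Finset.mem_univ _⟩
            (fun p : Fin K × Fin N => SINR g c σ p.1 p.2)) =
      min
        (Finset.univ.sup' Finset.univ_nonempty
          (fun t : Equiv.Perm (Fin K) × Equiv.Perm (Fin K) × Equiv.Perm (Fin K) =>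
            Finset.univ.inf' Finset.univ_nonempty
              (fun p : Fin K × Fin 3 =>
                SINR g c (ext3 t) p.1 (Fin.castLE (by omega) p.2))))
        ((Finset.univ.filter (fun n : Fin N => 3 ≤ (n : ℕ))).inf'
          ⟨⟨3, by omega⟩, Finset.mem_filter.mpr ⟨Finset.mem_univ _, le_refl 3⟩⟩
          (fun n : Fin N =>
            Finset.univ.sup' Finset.univ_nonempty
              (fun σ : Equiv.Perm (Fin K) =>
                Finset.univ.inf' Finset.univ_nonempty
                  (fun l : Fin K => g n n l (σ l) (σ l) / c))))) := by
  have isolated : ∀ (σ : Fin N → Equiv.Perm (Fin K)) (l : Fin K) (n : Fin N), 3 ≤ (n : ℕ) →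
      SINR g c σ l n = g n n l (σ n l) (σ n l) / c := fun σ l n hn =>
    SINR_eq_div_of_interference_eq_zero c σ l fun m hm k i => hzero n m l k i hm (.inl hn)
  have coupled : ∀ (σ σ' : Fin N → Equiv.Perm (Fin K)),
      (∀ m : Fin N, (m : ℕ) < 3 → σ m = σ' m) →
      ∀ (l : Fin K) (n : Fin N), (n : ℕ) < 3 → SINR g c σ l n = SINR g c σ' l n :=
    fun σ σ' h l n hn => SINR_congr c l (h n hn) fun m hm =>
      (lt_or_ge (m : ℕ) 3).imp (h m) fun hm3 k i => hzero n m l k i hm (.inr hm3)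
  refine ⟨isolated, coupled, le_antisymm ?_ ?_⟩
  · refine Finset.sup'_le _ _ fun σ _ => le_min ?_ (Finset.le_inf' _ _ fun n hn => ?_)
    · refine Finset.le_sup'_of_le _
        (Finset.mem_univ (σ ⟨0, by omega⟩, σ ⟨1, by omega⟩, σ ⟨2, by omega⟩))
        (Finset.le_inf' _ _ fun p _ => ?_)
      rw [coupled _ σ (fun m hm => ext3_apply_of_lt_three (by omega) σ hm) p.1 _ p.2.isLt]
      exact Finset.inf'_le (fun p : Fin K × Fin N => SINR g c σ p.1 p.2)
        (Finset.mem_univ (p.1, Fin.castLE (by omega) p.2))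
    · refine Finset.le_sup'_of_le _ (Finset.mem_univ (σ n)) (Finset.le_inf' _ _ fun l _ => ?_)
      rw [← isolated σ l n (Finset.mem_filter.mp hn).2]
      exact Finset.inf'_le (fun p : Fin K × Fin N => SINR g c σ p.1 p.2)
        (Finset.mem_univ (l, n))
  · obtain ⟨t, -, ht⟩ := Finset.exists_mem_eq_sup' Finset.univ_nonempty
      (fun t : Equiv.Perm (Fin K) × Equiv.Perm (Fin K) × Equiv.Perm (Fin K) =>
        Finset.univ.inf' Finset.univ_nonempty
          (fun p : Fin K × Fin 3 => SINR g c (ext3 t) p.1 (Fin.castLE (by omega) p.2)))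
    choose τ _ hτ using fun n : Fin N => Finset.exists_mem_eq_sup' Finset.univ_nonempty
      (fun σ : Equiv.Perm (Fin K) => Finset.univ.inf' Finset.univ_nonempty
        (fun l : Fin K => g n n l (σ l) (σ l) / c))
    refine Finset.le_sup'_of_le _
      (Finset.mem_univ fun m : Fin N => if (m : ℕ) < 3 then ext3 t m else τ m)
      (Finset.le_inf' _ _ fun ⟨l, n⟩ _ => ?_)
    rcases lt_or_ge (n : ℕ) 3 with hn | hn
    · refine (min_le_left _ _).trans ?_
      rw [ht, coupled _ (ext3 t) (fun m hm => if_pos hm) l n hn]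
      exact Finset.inf'_le
        (fun p : Fin K × Fin 3 => SINR g c (ext3 t) p.1 (Fin.castLE (by omega) p.2))
        (Finset.mem_univ (l, ⟨n, hn⟩))
    · refine (min_le_right _ _).trans ((Finset.inf'_le _
        (Finset.mem_filter.mpr ⟨Finset.mem_univ n, hn⟩)).trans ?_)
      rw [hτ, isolated _ l n hn, if_neg hn.not_gt]
      exact Finset.inf'_le (fun l : Fin K => g n n l (τ n l) (τ n l) / c) (Finset.mem_univ l)
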